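/- Let T = (V, E) be a finite tree with consistent, strictly positive singleton densities q_i and pairwise densities q_{ij}, and let q be the associated tree-structured joint density. For vertices i ≠ j connected in T, let i = u_0 → u_1 → ... → u_k = j be the unique path from i to j. Then the joint marginal of q over (z_i, z_j) equals ∫ ∏_{l=0}^{k−1} q_{u_l u_{l+1}}(z_{u_l}, z_{u_{l+1}}) ∏_{l=1}^{k−1} (dz_{u_l} / q_{u_l}(z_{u_l})), i.e., the belief-propagation formula gives the exact pairwise marginal along the path. -/

import Mathlib

open MeasureTheory Finset

/-- Assignment of values along a path: position `0` gets `x`, position `k` gets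
`y`, and intermediate position `l` gets `w (l-1)`. -/
def pathAssign (d k : ℕ) (x y : Fin d → ℝ) (w : Fin (k - 1) → (Fin d → ℝ))
    (l : Fin (k + 1)) : Fin d → ℝ :=
  if h0 : (l : ℕ) = 0 then x
  else if hk : (l : ℕ) = k then y
  else w ⟨(l : ℕ) - 1, by have := l.isLt; omega⟩

/-- Any two vertices of `S` are joined by a walk of `G` staying in `S`. -/
def SimpleGraph.WalkConnectedOn {V : Type*} (G : SimpleGraph V) (S : Finset V) : Prop :=
  ∀ a ∈ S, ∀ b ∈ S, ∃ p : G.Walk a b, ∀ c ∈ p.support, c ∈ S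

namespace SimpleGraph.WalkConnectedOn

variable {V : Type*} {G : SimpleGraph V} {S : Finset V}

theorem singleton (a : V) : G.WalkConnectedOn {a} := by
  intro b hb c hc
  obtain rfl := Finset.mem_singleton.1 hb
  obtain rfl := Finset.mem_singleton.1 hc
  exact ⟨.nil, by simp⟩

theorem insert [DecidableEq V] (hS : G.WalkConnectedOn S) {v w : V} (hw : w ∈ S)
    (hwv : G.Adj w v) : G.WalkConnectedOn (insert v S) := by
  have key : ∀ a ∈ Insert.insert v S, ∃ p : G.Walk a w, ∀ c ∈ p.support, c ∈ Insert.insert v S := by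
    intro a ha
    rcases Finset.mem_insert.1 ha with rfl | ha
    · refine ⟨.cons hwv.symm .nil, fun c hc => ?_⟩
      simp only [Walk.support_cons, Walk.support_nil, List.mem_cons, List.not_mem_nil,
        or_false] at hc
      rcases hc with rfl | rfl <;> simp [hw]
    · obtain ⟨p, hp⟩ := hS a ha w hw
      exact ⟨p, fun c hc => Finset.mem_insert_of_mem (hp c hc)⟩
  intro a ha b hb
  obtain ⟨p, hp⟩ := key a ha
  obtain ⟨r, hr⟩ := key b hb
  refine ⟨p.append r.reverse, fun c hc => ?_⟩
  rcases (Walk.mem_support_append_iff _ _).1 hc with h | h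
  · exact hp c h
  · exact hr c (by simpa using h)

/-- In an acyclic graph, a vertex outside a connected set has at most one neighbour in it. -/
theorem eq_of_adj [DecidableEq V] (hS : G.WalkConnectedOn S) (hG : G.IsAcyclic) {v w w' : V}
    (hv : v ∉ S) (hw : w ∈ S) (hw' : w' ∈ S) (h : G.Adj w v) (h' : G.Adj w' v) : w' = w := by
  by_contra hne
  obtain ⟨p, hp⟩ := hS w hw w' hw'
  have hpath : (Walk.cons h (.cons h'.symm .nil)).IsPath := by
    simp [Walk.cons_isPath_iff, h.ne, h'.ne', Ne.symm hne]
  have heq := (hG.subsingleton_path w w').elim ⟨_, hpath⟩ p.toPath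
  have hmem : v ∈ (p.toPath : G.Walk w w').support := by
    rw [← heq]; simp
  exact hv (hp v (p.support_bypass_subset_support hmem))

/-- A connected set grows to the whole vertex set by adding adjacent vertices. -/
theorem induction_univ [Fintype V] [DecidableEq V] (hG : G.Preconnected) {P : Finset V}
    (hP : G.WalkConnectedOn P) (hne : P.Nonempty) {motive : Finset V → Prop} (base : motive P)
    (step : ∀ S, P ⊆ S → G.WalkConnectedOn S → ∀ v ∉ S, ∀ w ∈ S, G.Adj w v →
      motive S → motive (Insert.insert v S)) : motive Finset.univ := by
  suffices ∀ n (S : Finset V), Sᶜ.card = n → P ⊆ S → G.WalkConnectedOn S → motive S →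
      motive Finset.univ from this _ P rfl subset_rfl hP base
  intro n
  induction n with
  | zero =>
    intro S hn _ _ h
    rw [Finset.card_eq_zero, Finset.compl_eq_empty_iff] at hn
    exact hn ▸ h
  | succ n ih =>
    intro S hn hPS hS h
    obtain ⟨b, hb⟩ : Sᶜ.Nonempty := Finset.card_pos.1 (by omega)
    obtain ⟨a, ha⟩ := hne.mono hPS
    obtain ⟨p⟩ := hG a b
    obtain ⟨e, -, h1, h2⟩ := p.exists_boundary_dart (S : Set V) (by simpa using ha)
      (by simpa using hb)
    have h1 : e.fst ∈ S := by simpa using h1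
    have h2 : e.snd ∉ S := by simpa using h2
    refine ih (Insert.insert e.snd S) ?_ (hPS.trans (Finset.subset_insert _ _))
      (hS.insert h1 e.adj) (step S hPS hS _ h2 _ h1 e.adj h)
    rw [Finset.card_compl, Finset.card_insert_of_notMem h2]
    rw [Finset.card_compl] at hn
    omega

end SimpleGraph.WalkConnectedOn

/-- Reindexing a partial marginal along an injective enumeration of the integrated variables. -/
theorem MeasureTheory.lmarginal_eq_lintegral_pi {V ι α : Type*} [DecidableEq V] [Fintype ι]
    [MeasurableSpace α] (μ : Measure α) [SigmaFinite μ] (s : Finset V) (e : ι → V)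
    (he : Function.Injective e) (hes : ∀ v, v ∈ s ↔ ∃ l, e l = v) (f : (V → α) → ENNReal)
    (z₀ : V → α) (g : (ι → α) → V → α) (hg : ∀ w l, g w (e l) = w l)
    (hg₀ : ∀ w, ∀ v ∉ s, g w v = z₀ v) :
    lmarginal (fun _ => μ) s f z₀ = ∫⁻ w, f (g w) ∂Measure.pi (fun _ => μ) := by
  let φ : ι ≃ s := Equiv.ofBijective (fun l => ⟨e l, (hes _).2 ⟨l, rfl⟩⟩)
    ⟨fun a b h => he (congrArg Subtype.val h), fun ⟨v, hv⟩ => by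
      obtain ⟨l, rfl⟩ := (hes v).1 hv
      exact ⟨l, rfl⟩⟩
  have hmp := measurePreserving_piCongrLeft (fun _ : s => μ) φ
  rw [lmarginal, ← hmp.lintegral_comp_emb (MeasurableEquiv.measurableEmbedding _)]
  refine lintegral_congr fun w => congrArg f (funext fun v => ?_)
  by_cases hv : v ∈ s
  · obtain ⟨l, rfl⟩ := (hes v).1 hv
    rw [hg, Function.updateFinset, dif_pos hv]
    exact MeasurableEquiv.piCongrLeft_apply_apply (β := fun _ => α) φ w l
  · rw [hg₀ w v hv, Function.updateFinset, dif_neg hv]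

/-- The restriction of the tree-structured density to the subgraph induced by `S`. -/
noncomputable def treeDensityOn {V α : Type*} [DecidableEq V] (E : Finset (V × V))
    (q1 : V → α → ℝ) (q2 : V → V → α → α → ℝ) (S : Finset V) (z : V → α) : ℝ :=
  (∏ v ∈ S, q1 v (z v)) * ∏ e ∈ E with e.1 ∈ S ∧ e.2 ∈ S,
    q2 e.1 e.2 (z e.1) (z e.2) / (q1 e.1 (z e.1) * q1 e.2 (z e.2))

section TreeDensity

variable {V α : Type*} [DecidableEq V] {E : Finset (V × V)} {T : SimpleGraph V}
  {q1 : V → α → ℝ} {q2 : V → V → α → α → ℝ} {S : Finset V}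

theorem treeDensityOn_nonneg (h1 : ∀ i x, 0 < q1 i x) (h2 : ∀ i j x y, 0 < q2 i j x y)
    (z : V → α) : 0 ≤ treeDensityOn E q1 q2 S z :=
  mul_nonneg (Finset.prod_nonneg fun v _ => (h1 v _).le) (Finset.prod_nonneg fun _ _ =>
    div_nonneg (h2 _ _ _ _).le (mul_nonneg (h1 _ _).le (h1 _ _).le))

theorem measurable_treeDensityOn [MeasurableSpace α] (h1 : ∀ i, Measurable (q1 i))
    (h2 : ∀ i j, Measurable fun r : α × α => q2 i j r.1 r.2) :
    Measurable (treeDensityOn E q1 q2 S) := by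
  have hq1 : ∀ v, Measurable fun z : V → α => q1 v (z v) :=
    fun v => (h1 v).comp (measurable_pi_apply v)
  refine (Finset.measurable_prod _ fun v _ => hq1 v).mul
    (Finset.measurable_prod _ fun e _ => ?_)
  exact ((h2 e.1 e.2).comp ((measurable_pi_apply e.1).prodMk (measurable_pi_apply e.2))).div
    ((hq1 _).mul (hq1 _))

theorem treeDensityOn_update {v : V} (hv : v ∉ S) (z : V → α) (a : α) :
    treeDensityOn E q1 q2 S (Function.update z v a) = treeDensityOn E q1 q2 S z := by
  have h : ∀ w ∈ S, Function.update z v a w = z w := fun w hw =>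
    Function.update_of_ne (ne_of_mem_of_not_mem hw hv) _ _
  unfold treeDensityOn
  congr 1
  · exact Finset.prod_congr rfl fun w hw => by rw [h w hw]
  · refine Finset.prod_congr rfl fun e he => ?_
    obtain ⟨-, h1, h2⟩ := Finset.mem_filter.1 he
    rw [h _ h1, h _ h2]

/-- Attaching a leaf `v` at `w` multiplies the density by the conditional density of `v`
given `w`. -/
theorem treeDensityOn_insert (hTE : ∀ a b : V, T.Adj a b ↔ ((a, b) ∈ E ∨ (b, a) ∈ E))
    (hE : ∀ e ∈ E, (e.2, e.1) ∉ E) (h1 : ∀ i x, 0 < q1 i x)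
    (hsymm : ∀ i j x y, q2 i j x y = q2 j i y x) {v w : V} (hv : v ∉ S) (hw : w ∈ S)
    (hwv : T.Adj w v) (huniq : ∀ w' ∈ S, T.Adj w' v → w' = w) (z : V → α) :
    treeDensityOn E q1 q2 (insert v S) z =
      treeDensityOn E q1 q2 S z * (q2 w v (z w) (z v) / q1 w (z w)) := by
  obtain ⟨e₀, he₀, hval, hfilter⟩ : ∃ e₀ : V × V, ¬ (e₀.1 ∈ S ∧ e₀.2 ∈ S) ∧
      q2 e₀.1 e₀.2 (z e₀.1) (z e₀.2) / (q1 e₀.1 (z e₀.1) * q1 e₀.2 (z e₀.2)) =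
        q2 w v (z w) (z v) / (q1 w (z w) * q1 v (z v)) ∧
      {e ∈ E | e.1 ∈ insert v S ∧ e.2 ∈ insert v S} =
        insert e₀ {e ∈ E | e.1 ∈ S ∧ e.2 ∈ S} := by
    have hne := hwv.ne
    have hloop : (v, v) ∉ E := fun h => T.loopless.irrefl v ((hTE v v).2 (.inl h))
    have hl : ∀ a ∈ S, (a, v) ∈ E → a = w := fun a ha h => huniq a ha ((hTE _ _).2 (.inl h))
    have hr : ∀ a ∈ S, (v, a) ∈ E → a = w := fun a ha h => huniq a ha ((hTE _ _).2 (.inr h))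
    rcases (hTE w v).1 hwv with h | h
    · refine ⟨(w, v), fun h => hv h.2, rfl, ?_⟩
      ext ⟨a, b⟩
      have := hE _ h
      simp only [Finset.mem_filter, Finset.mem_insert, Prod.mk.injEq]
      grind
    · refine ⟨(v, w), fun h => hv h.1, by dsimp only; rw [hsymm, mul_comm], ?_⟩
      ext ⟨a, b⟩
      have := hE _ h
      simp only [Finset.mem_filter, Finset.mem_insert, Prod.mk.injEq]
      grind
  unfold treeDensityOn
  have hmem : e₀ ∉ {e ∈ E | e.1 ∈ S ∧ e.2 ∈ S} := fun h => he₀ (Finset.mem_filter.1 h).2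
  rw [hfilter, Finset.prod_insert hv, Finset.prod_insert hmem, hval]
  have := (h1 v (z v)).ne'
  have := (h1 w (z w)).ne'
  field_simp

/-- Along a path of a tree the density is the product of the successive transition densities. -/
theorem treeDensityOn_path (hT : T.IsAcyclic)
    (hTE : ∀ a b : V, T.Adj a b ↔ ((a, b) ∈ E ∨ (b, a) ∈ E))
    (hE : ∀ e ∈ E, (e.2, e.1) ∉ E) (h1 : ∀ i x, 0 < q1 i x)
    (hsymm : ∀ i j x y, q2 i j x y = q2 j i y x) (u : ℕ → V) (k : ℕ)
    (hinj : Set.InjOn u (Set.Iic k)) (hadj : ∀ n < k, T.Adj (u n) (u (n + 1))) :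
    T.WalkConnectedOn ((Finset.range (k + 1)).image u) ∧ ∀ z,
      treeDensityOn E q1 q2 ((Finset.range (k + 1)).image u) z = q1 (u 0) (z (u 0)) *
        ∏ n ∈ Finset.range k,
          q2 (u n) (u (n + 1)) (z (u n)) (z (u (n + 1))) / q1 (u n) (z (u n)) := by
  induction k with
  | zero =>
    refine ⟨by simpa using SimpleGraph.WalkConnectedOn.singleton (u 0), fun z => ?_⟩
    have : {e ∈ E | e.1 = u 0 ∧ e.2 = u 0} = ∅ := by
      refine Finset.filter_eq_empty_iff.2 ?_
      rintro ⟨a, b⟩ he ⟨rfl, hb⟩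
      dsimp only at hb
      subst hb
      exact hE _ he he
    simp [treeDensityOn, this]
  | succ k ih =>
    obtain ⟨hconn, hval⟩ := ih (hinj.mono (Set.Iic_subset_Iic.2 k.le_succ))
      fun n hn => hadj n (by omega)
    have hmem : u k ∈ (Finset.range (k + 1)).image u :=
      Finset.mem_image_of_mem u (Finset.self_mem_range_succ k)
    have hnot : u (k + 1) ∉ (Finset.range (k + 1)).image u := by
      intro h
      obtain ⟨n, hn, hnk⟩ := Finset.mem_image.1 h
      have hn := Finset.mem_range.1 hn
      have := hinj (Set.mem_Iic.2 (by omega)) (Set.mem_Iic.2 le_rfl) hnk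
      omega
    have hk := hadj k k.lt_succ_self
    rw [Finset.range_add_one, Finset.image_insert]
    refine ⟨hconn.insert hmem hk, fun z => ?_⟩
    rw [treeDensityOn_insert hTE hE h1 hsymm hnot hmem hk
      (fun w' hw' h => hconn.eq_of_adj hT hnot hmem hw' hk h), hval, Finset.prod_range_succ,
      mul_assoc]

/-- Integrating out a leaf of the tree removes it from the density. -/
theorem lmarginal_treeDensityOn_insert [MeasurableSpace α] (μ : Measure α) [SigmaFinite μ]
    (hTE : ∀ a b : V, T.Adj a b ↔ ((a, b) ∈ E ∨ (b, a) ∈ E))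
    (hE : ∀ e ∈ E, (e.2, e.1) ∉ E) (h1meas : ∀ i, Measurable (q1 i))
    (h2meas : ∀ i j, Measurable fun r : α × α => q2 i j r.1 r.2)
    (h1 : ∀ i x, 0 < q1 i x) (h2 : ∀ i j x y, 0 < q2 i j x y)
    (hsymm : ∀ i j x y, q2 i j x y = q2 j i y x)
    (hcons : ∀ i j x, ∫ y, q2 i j x y ∂μ = q1 i x) {v w : V} (hv : v ∉ S) (hw : w ∈ S)
    (hwv : T.Adj w v) (huniq : ∀ w' ∈ S, T.Adj w' v → w' = w) {R : Finset V} (hR : R ⊆ S) :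
    lmarginal (fun _ => μ) ((insert v S) \ R)
        (fun z => ENNReal.ofReal (treeDensityOn E q1 q2 (insert v S) z)) =
      lmarginal (fun _ => μ) (S \ R)
        (fun z => ENNReal.ofReal (treeDensityOn E q1 q2 S z)) := by
  rw [Finset.insert_sdiff_of_notMem _ (fun h => hv (hR h)),
    lmarginal_insert' _ (measurable_treeDensityOn h1meas h2meas).ennreal_ofReal
      (fun h => hv (Finset.mem_sdiff.1 h).1)]
  congr 1
  funext z
  have hint : Integrable (q2 w v (z w)) μ := by
    by_contra h
    exact (h1 w (z w)).ne' ((hcons w v (z w)).symm.trans (integral_undef h))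
  have hmeas : Measurable fun a => ENNReal.ofReal (q2 w v (z w) a) :=
    ((h2meas w v).comp measurable_prodMk_left).ennreal_ofReal
  have hlint : ∫⁻ a, ENNReal.ofReal (q2 w v (z w) a) ∂μ = ENNReal.ofReal (q1 w (z w)) := by
    rw [← ofReal_integral_eq_lintegral_ofReal hint (.of_forall fun a => (h2 _ _ _ _).le), hcons]
  have hnn : 0 ≤ treeDensityOn E q1 q2 S z / q1 w (z w) :=
    div_nonneg (treeDensityOn_nonneg h1 h2 z) (h1 _ _).le
  calc ∫⁻ a, ENNReal.ofReal (treeDensityOn E q1 q2 (insert v S) (Function.update z v a)) ∂μ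
      = ∫⁻ a, ENNReal.ofReal (treeDensityOn E q1 q2 S z / q1 w (z w)) *
          ENNReal.ofReal (q2 w v (z w) a) ∂μ := by
        refine lintegral_congr fun a => ?_
        rw [treeDensityOn_insert hTE hE h1 hsymm hv hw hwv huniq, treeDensityOn_update hv,
          Function.update_self, Function.update_of_ne hwv.ne, ← ENNReal.ofReal_mul hnn]
        congr 1
        ring
    _ = ENNReal.ofReal (treeDensityOn E q1 q2 S z) := by
        rw [lintegral_const_mul _ hmeas, hlint, ← ENNReal.ofReal_mul hnn,
          div_mul_cancel₀ _ (h1 _ _).ne']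

end TreeDensity

/-- Belief-propagation refinement formula: for a tree-structured joint density
`q` over a finite tree, the pairwise marginal of `q` over `(z_i, z_j)` equals
the integral along the unique path `i = u_0 → u_1 → ⋯ → u_k = j` of the product
of the pairwise densities divided by the intermediate singleton densities. -/
theorem belief_propagation_pairwise_marginal {V : Type*} [Fintype V] [DecidableEq V]
    (d : ℕ) (E : Finset (V × V))
    (T : SimpleGraph V)
    (hT : T.IsTree)
    (hTE : ∀ a b : V, T.Adj a b ↔ ((a, b) ∈ E ∨ (b, a) ∈ E))
    (hEirr : ∀ e ∈ E, e.1 ≠ e.2)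
    (hEonce : ∀ e ∈ E, (e.2, e.1) ∉ E)
    (q1 : V → (Fin d → ℝ) → ℝ)
    (q2 : V → V → (Fin d → ℝ) → (Fin d → ℝ) → ℝ)
    (h1meas : ∀ i, Measurable (q1 i))
    (h2meas : ∀ i j, Measurable (fun r : (Fin d → ℝ) × (Fin d → ℝ) => q2 i j r.1 r.2))
    (h1pos : ∀ i x, 0 < q1 i x)
    (h2pos : ∀ i j x y, 0 < q2 i j x y)
    (h1int : ∀ i, ∫ x, q1 i x = 1)
    (hsymm : ∀ i j x y, q2 i j x y = q2 j i y x)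
    (hcons : ∀ i j x, ∫ y, q2 i j x y = q1 i x)
    (q : (V → (Fin d → ℝ)) → ℝ)
    (hq : ∀ z, q z = (∏ i, q1 i (z i)) *
      ∏ e ∈ E, q2 e.1 e.2 (z e.1) (z e.2) / (q1 e.1 (z e.1) * q1 e.2 (z e.2)))
    (i j : V) (hij : i ≠ j)
    (k : ℕ) (hk : 1 ≤ k)
    (u : Fin (k + 1) → V)
    (hu0 : u 0 = i) (huk : u (Fin.last k) = j)
    (huinj : Function.Injective u)
    (hupath : ∀ l : Fin k, T.Adj (u l.castSucc) (u l.succ)) :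
    ∀ x y : Fin d → ℝ,
      (∫ z : {v : V // v ≠ i ∧ v ≠ j} → (Fin d → ℝ),
        q (fun v => if h : v = i then x else if h' : v = j then y
          else z ⟨v, ⟨h, h'⟩⟩))
      = ∫ w : Fin (k - 1) → (Fin d → ℝ),
          (∏ l : Fin k, q2 (u l.castSucc) (u l.succ)
            (pathAssign d k x y w l.castSucc) (pathAssign d k x y w l.succ)) *
          ∏ l : Fin (k - 1),
            (q1 (u ⟨(l : ℕ) + 1, by have := l.isLt; omega⟩) (w l))⁻¹ := by
  intro x y
  obtain ⟨m, rfl⟩ : ∃ m, k = m + 1 := ⟨k - 1, by omega⟩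
  set U : ℕ → V := fun n => u ⟨min n (m + 1), by omega⟩ with hU
  have hUu : ∀ n (hn : n < m + 1 + 1), U n = u ⟨n, hn⟩ := fun n hn => by
    simp only [hU]; congr 2; omega
  have hUinj : Set.InjOn U (Set.Iic (m + 1)) := fun a ha b hb h => by
    rw [Set.mem_Iic] at ha hb
    rw [hUu a (by omega), hUu b (by omega)] at h
    simpa using huinj h
  have hUadj : ∀ n < m + 1, T.Adj (U n) (U (n + 1)) := fun n hn => by
    rw [hUu n (by omega), hUu (n + 1) (by omega)]
    exact hupath ⟨n, hn⟩
  have hU0 : U 0 = i := (hUu 0 (by omega)).trans hu0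
  have hUk : U (m + 1) = j := (hUu (m + 1) (by omega)).trans huk
  obtain ⟨hPconn, hPval⟩ := treeDensityOn_path (q1 := q1) (q2 := q2) hT.isAcyclic hTE hEonce h1pos
    hsymm U (m + 1) hUinj hUadj
  set P : Finset V := (Finset.range (m + 1 + 1)).image U with hP
  have hiP : i ∈ P := hU0 ▸ Finset.mem_image_of_mem U (by simp)
  have hjP : j ∈ P := hUk ▸ Finset.mem_image_of_mem U (by simp)
  have hRP : ({i, j} : Finset V) ⊆ P := by
    simp [Finset.insert_subset_iff, hiP, hjP]
  have hmarg : lmarginal (fun _ => (volume : Measure (Fin d → ℝ))) (Finset.univ \ {i, j})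
        (fun z => ENNReal.ofReal (treeDensityOn E q1 q2 Finset.univ z)) =
      lmarginal (fun _ => volume) (P \ {i, j})
        (fun z => ENNReal.ofReal (treeDensityOn E q1 q2 P z)) := by
    refine hPconn.induction_univ hT.connected.preconnected ⟨i, hiP⟩
      (motive := fun S => lmarginal (fun _ => (volume : Measure (Fin d → ℝ))) (S \ {i, j})
        (fun z => ENNReal.ofReal (treeDensityOn E q1 q2 S z)) = _) rfl ?_
    intro S hPS hS v hv w hw hwv ih
    rw [← ih]
    exact lmarginal_treeDensityOn_insert volume hTE hEonce h1meas h2meas h1pos h2pos hsymm hcons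
      hv hw hwv (fun w' hw' h => hS.eq_of_adj hT.isAcyclic hv hw hw' hwv h) (hRP.trans hPS)
  have hquniv : q = treeDensityOn E q1 q2 Finset.univ := funext fun z => by
    simp [treeDensityOn, hq]
  set z₀ : V → Fin d → ℝ := fun v => if v = i then x else y with hz₀
  -- the assignment extending `z₀` by `w` at the inner vertices of the path
  let g : (Fin m → Fin d → ℝ) → V → Fin d → ℝ := fun w v =>
    if h : ∃ l : Fin (m + 1 + 1), u l = v then pathAssign d (m + 1) x y w h.choose else z₀ v
  have hgu : ∀ w l, g w (u l) = pathAssign d (m + 1) x y w l := fun w l => by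
    have h : ∃ l', u l' = u l := ⟨l, rfl⟩
    simp only [g, dif_pos h]
    rw [huinj h.choose_spec]
  have hinner : ∀ l : Fin m, (l : ℕ) + 1 < m + 1 + 1 := fun l => by omega
  have hPmem : ∀ v, v ∈ P ↔ ∃ l, u l = v := fun v => by
    simp only [hP, Finset.mem_image, Finset.mem_range]
    constructor
    · rintro ⟨n, hn, rfl⟩
      exact ⟨_, (hUu n hn).symm⟩
    · rintro ⟨l, rfl⟩
      exact ⟨l, l.isLt, hUu l l.isLt⟩
  have hleft : lmarginal (fun _ => (volume : Measure (Fin d → ℝ))) (Finset.univ \ {i, j})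
        (fun z => ENNReal.ofReal (treeDensityOn E q1 q2 Finset.univ z)) z₀ =
      ∫⁻ z : {v : V // v ≠ i ∧ v ≠ j} → (Fin d → ℝ), ENNReal.ofReal
        (q (fun v => if h : v = i then x else if h' : v = j then y else z ⟨v, ⟨h, h'⟩⟩)) := by
    rw [hquniv]
    refine lmarginal_eq_lintegral_pi volume _ Subtype.val Subtype.val_injective ?_ _ z₀
      (fun z v => if h : v = i then x else if h' : v = j then y else z ⟨v, ⟨h, h'⟩⟩) ?_ ?_
    · intro v
      simp
    · rintro w ⟨v, hvi, hvj⟩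
      simp [hvi, hvj]
    · intro w v hv
      by_cases hvi : v = i
      · simp [hz₀, hvi]
      · have hvj : v = j := by simpa [hvi] using hv
        simp [hz₀, hvj]
  have hright : lmarginal (fun _ => (volume : Measure (Fin d → ℝ))) (P \ {i, j})
        (fun z => ENNReal.ofReal (treeDensityOn E q1 q2 P z)) z₀ =
      ∫⁻ w : Fin m → (Fin d → ℝ), ENNReal.ofReal (treeDensityOn E q1 q2 P (g w)) := by
    refine lmarginal_eq_lintegral_pi volume _ (fun l : Fin m => u ⟨l + 1, hinner l⟩)
      (fun a b h => ?_) (fun v => ?_) _ z₀ g (fun w l => ?_) (fun w v hv => ?_)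
    · have := huinj h
      simp only [Fin.mk.injEq] at this
      exact Fin.ext (by omega)
    · simp only [Finset.mem_sdiff, hPmem, Finset.mem_insert, Finset.mem_singleton, not_or]
      constructor
      · rintro ⟨⟨l, rfl⟩, hi, hj⟩
        have h0 : l ≠ 0 := fun h => hi (h ▸ hu0)
        have h1 : l ≠ Fin.last _ := fun h => hj (h ▸ huk)
        have h0' : (l : ℕ) ≠ 0 := fun h => h0 (Fin.ext h)
        have h1' : (l : ℕ) ≠ m + 1 := fun h => h1 (Fin.ext h)
        exact ⟨⟨l - 1, by omega⟩, congrArg u (Fin.ext (by dsimp only; omega))⟩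
      · rintro ⟨l, rfl⟩
        refine ⟨⟨_, rfl⟩, ?_, ?_⟩
        · rw [← hu0]
          exact fun h => by simpa using congrArg Fin.val (huinj h)
        · rw [← huk]
          intro h
          have := congrArg Fin.val (huinj h)
          simp only [Fin.val_last] at this
          omega
    · rw [hgu, pathAssign, dif_neg (by simp), dif_neg (by dsimp only; omega)]
      rfl
    · have hv : v ∈ P → v = i ∨ v = j := by
        intro h
        by_contra hc
        exact hv (by simpa [h] using hc)
      by_cases hvP : v ∈ P
      · rcases hv hvP with rfl | rfl
        · rw [← hu0, hgu]
          simp [pathAssign, hz₀, hu0]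
        · rw [← huk, hgu]
          simp [pathAssign, hz₀, huk, hij.symm]
      · exact dif_neg (fun h => hvP ((hPmem v).2 h))
  have hPg : ∀ w : Fin m → (Fin d → ℝ), treeDensityOn E q1 q2 P (g w) =
      (∏ l : Fin (m + 1), q2 (u l.castSucc) (u l.succ)
        (pathAssign d (m + 1) x y w l.castSucc) (pathAssign d (m + 1) x y w l.succ)) *
      ∏ l : Fin m, (q1 (u ⟨(l : ℕ) + 1, hinner l⟩) (w l))⁻¹ := by
    intro w
    have hq1 := (h1pos (U 0) (g w (U 0))).ne'
    rw [hPval]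
    simp only [div_eq_mul_inv]
    rw [Finset.prod_mul_distrib, Finset.prod_range_succ' (fun n => (q1 (U n) (g w (U n)))⁻¹),
      mul_comm (∏ n ∈ Finset.range m, _) _, mul_left_comm, mul_inv_cancel_left₀ hq1,
      Finset.prod_range, Finset.prod_range]
    congr 1
    · refine Finset.prod_congr rfl fun l _ => ?_
      rw [← hgu, ← hgu, hUu l (by omega), hUu (l + 1) (by omega)]
      rfl
    · refine Finset.prod_congr rfl fun l _ => ?_
      rw [hUu (l + 1) (by omega), hgu, pathAssign, dif_neg (by simp),
        dif_neg (by dsimp only; omega)]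
      rfl
  have hmeasg : Measurable g := by
    refine measurable_pi_lambda _ fun v => ?_
    by_cases h : ∃ l : Fin (m + 1 + 1), u l = v
    · obtain ⟨l, rfl⟩ := h
      simp only [hgu, pathAssign]
      split_ifs
      exacts [measurable_const, measurable_const, measurable_pi_apply _]
    · simp only [g, dif_neg h]
      exact measurable_const
  have hmeasz : Measurable fun (z : {v : V // v ≠ i ∧ v ≠ j} → (Fin d → ℝ)) (v : V) =>
      if h : v = i then x else if h' : v = j then y else z ⟨v, ⟨h, h'⟩⟩ := by
    refine measurable_pi_lambda _ fun v => ?_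
    split_ifs
    exacts [measurable_const, measurable_const, measurable_pi_apply _]
  have hmeas : ∀ S, Measurable (treeDensityOn E q1 q2 S) :=
    fun _ => measurable_treeDensityOn h1meas h2meas
  have hnn : ∀ S z, 0 ≤ treeDensityOn E q1 q2 S z := fun _ => treeDensityOn_nonneg h1pos h2pos
  refine Eq.trans ?_ (integral_congr_ae (μ := (volume : Measure (Fin m → Fin d → ℝ)))
    (.of_forall hPg))
  rw [integral_eq_lintegral_of_nonneg_ae
      (.of_forall fun _ => by rw [hquniv]; exact hnn _ _)
      (by rw [hquniv]; exact ((hmeas _).comp hmeasz).aestronglyMeasurable),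
    integral_eq_lintegral_of_nonneg_ae (.of_forall fun _ => hnn _ _)
      ((hmeas _).comp hmeasg).aestronglyMeasurable]
  exact congrArg ENNReal.toReal (hleft.symm.trans ((congrFun hmarg z₀).trans hright))
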